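/- arXiv:2511.20556 — 2 statements merged into one kernel-verified Lean document; each statement's English description precedes it below -/
import Mathlib

section
/- Let λ > 0, β, β' ∈ (0,1/2), K ≥ 0, and let (X_t)_{t≥0} be a real-valued centered Gaussian process with continuous sample paths and X₀ = 0, such that E[(X_t − X_s)²] ≤ (t−s)^{2β} ∨ (t−s)^{2β'} for all 0 ≤ s < t, and E[(X_t − X_v)(X_v − X_s)] ≤ K·( ((t−v)^β (v−s)^β) ∨ ((t−v)^{β'} (v−s)^{β'}) ) for all 0 ≤ s < v < t. Then there exists a constant C = C(λ, β, β', K) such that for every m ≥ 1 one has sup_{t ≥ 0} ‖Z_t‖_{L^m(Ω)} ≤ C·√m, where Z_t := e^{−λt} X_t + λ·∫_0^t e^{−λ(t−r)} (X_t − X_r) dr. -/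
open MeasureTheory ProbabilityTheory

lemma aux_pointwise (m x : ℝ) (hm : 1 ≤ m) :
    |x| ^ m ≤ (Real.sqrt m) ^ m * Real.exp (-m) *
      (Real.exp (Real.sqrt m * x) + Real.exp (-Real.sqrt m * x)) := by
  have hm0 : 0 < m := by linarith
  set s := Real.sqrt m with hs
  have hs0 : 0 < s := Real.sqrt_pos.2 hm0
  have hss : s * s = m := Real.mul_self_sqrt hm0.le
  have h1 : |x| / s ≤ Real.exp (|x| / s - 1) := by
    have := Real.add_one_le_exp (|x| / s - 1); linarith
  have h2 : (|x| / s) ^ m ≤ Real.exp (s * |x| - m) := by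
    calc (|x| / s) ^ m ≤ (Real.exp (|x| / s - 1)) ^ m :=
          Real.rpow_le_rpow (by positivity) h1 hm0.le
      _ = Real.exp (s * |x| - m) := by
          rw [← Real.exp_mul]
          congr 1
          rw [← hss]; field_simp
  have h3 : |x| ^ m = s ^ m * (|x| / s) ^ m := by
    rw [← Real.mul_rpow hs0.le (by positivity)]
    congr 1; field_simp
  have h4 : Real.exp (s * |x|) ≤ Real.exp (s * x) + Real.exp (-s * x) := by
    rcases abs_cases x with ⟨h, _⟩ | ⟨h, _⟩ <;> rw [h]
    · have := Real.exp_pos (-s * x); linarith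
    · have := Real.exp_pos (s * x)
      rw [show s * -x = -s * x by ring]; linarith
  rw [h3]
  calc s ^ m * (|x| / s) ^ m ≤ s ^ m * Real.exp (s * |x| - m) := by gcongr
    _ = s ^ m * Real.exp (-m) * Real.exp (s * |x|) := by
      rw [mul_assoc, ← Real.exp_add]; congr 2; ring
    _ ≤ _ := by gcongr

/-- Gaussian moments with variance at most one. -/
lemma aux_gauss (m : ℝ) (hm : 1 ≤ m) (v : NNReal) (hv : (v : ℝ) ≤ 1) :
    eLpNorm (fun x : ℝ => x) (ENNReal.ofReal m) (gaussianReal 0 v)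
      ≤ ENNReal.ofReal (2 * Real.sqrt m) := by
  have hm0 : 0 < m := by linarith
  set s := Real.sqrt m with hs
  have hs0 : 0 < s := Real.sqrt_pos.2 hm0
  have hss : s ^ 2 = m := Real.sq_sqrt hm0.le
  have hmgf : ∀ u : ℝ, ∫ x, Real.exp (u * x) ∂(gaussianReal 0 v) = Real.exp (v * u ^ 2 / 2) := by
    intro u
    have := congrFun (mgf_id_gaussianReal (μ := 0) (v := v)) u
    simpa [mgf] using this
  have hI : ∀ u : ℝ, Integrable (fun x => Real.exp (u * x)) (gaussianReal 0 v) :=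
    fun u => integrable_exp_mul_gaussianReal u
  rw [eLpNorm_eq_lintegral_rpow_enorm_toReal (by simpa using hm0) ENNReal.ofReal_ne_top,
    ENNReal.toReal_ofReal hm0.le]
  have hb : ∫⁻ x, ‖x‖ₑ ^ m ∂(gaussianReal 0 v) ≤ ENNReal.ofReal ((2 * s) ^ m) := by
    calc ∫⁻ x, ‖x‖ₑ ^ m ∂(gaussianReal 0 v)
        ≤ ∫⁻ x, ENNReal.ofReal (s ^ m * Real.exp (-m) *
            (Real.exp (s * x) + Real.exp (-s * x))) ∂(gaussianReal 0 v) := by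
          refine lintegral_mono fun x => ?_
          rw [Real.enorm_eq_ofReal_abs, ENNReal.ofReal_rpow_of_nonneg (abs_nonneg _) hm0.le]
          exact ENNReal.ofReal_le_ofReal (aux_pointwise m x hm)
      _ = ENNReal.ofReal (∫ x, s ^ m * Real.exp (-m) *
            (Real.exp (s * x) + Real.exp (-s * x)) ∂(gaussianReal 0 v)) := by
          rw [ofReal_integral_eq_lintegral_ofReal]
          · exact ((hI s).add (hI (-s))).const_mul _
          · exact Filter.Eventually.of_forall fun x => by dsimp; positivity
      _ ≤ _ := by
          apply ENNReal.ofReal_le_ofReal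
          rw [integral_const_mul, integral_add (hI s) (hI (-s)), hmgf, hmgf, neg_sq, hss,
            Real.mul_rpow (by norm_num) hs0.le]
          have h1 : Real.exp (v * m / 2) ≤ Real.exp m := by
            apply Real.exp_le_exp.2; nlinarith [v.2]
          have h2 : (2 : ℝ) ≤ 2 ^ m := by
            simpa using Real.rpow_le_rpow_of_exponent_le (x := 2) (by norm_num) hm
          have h3 : Real.exp (-m) * Real.exp m = 1 := by rw [← Real.exp_add]; simp
          calc s ^ m * Real.exp (-m) * (Real.exp (v * m / 2) + Real.exp (v * m / 2))
              ≤ s ^ m * Real.exp (-m) * (Real.exp m + Real.exp m) := by gcongr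
            _ = s ^ m * (2 * (Real.exp (-m) * Real.exp m)) := by ring
            _ = 2 * s ^ m := by rw [h3]; ring
            _ ≤ _ := by gcongr
  calc _ ≤ (ENNReal.ofReal ((2 * s) ^ m)) ^ (1 / m) := by gcongr
    _ = _ := by
      rw [ENNReal.ofReal_rpow_of_nonneg (by positivity) (by positivity),
        ← Real.rpow_mul (by positivity), mul_one_div_cancel hm0.ne', Real.rpow_one]

/-- A crude Minkowski integral inequality. -/
lemma aux_mink {Ω : Type} [MeasurableSpace Ω] (P : Measure Ω) [IsProbabilityMeasure P]
    (μ : Measure ℝ) [IsFiniteMeasure μ] (f : ℝ → Ω → ℝ)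
    (hf : Measurable (Function.uncurry f)) (g : Ω → ℝ) (m : ℝ) (hm : 1 ≤ m)
    (A : ENNReal) (hA : ∀ᵐ r ∂μ, eLpNorm (f r) (ENNReal.ofReal m) P ≤ A)
    (hg : ∀ ω, ‖g ω‖ₑ ≤ ∫⁻ r, ‖f r ω‖ₑ ∂μ) :
    eLpNorm g (ENNReal.ofReal m) P ≤ A * μ Set.univ := by
  have hm0 : 0 < m := by linarith
  have hp0 : ENNReal.ofReal m ≠ 0 := by simpa using hm0
  have key : ∀ ω, ‖g ω‖ₑ ^ m ≤ (∫⁻ r, ‖f r ω‖ₑ ^ m ∂μ) * (μ Set.univ) ^ (m - 1) := by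
    intro ω
    have hfm : Measurable (fun r => f r ω) := hf.comp (by fun_prop : Measurable fun r => (r, ω))
    have h1 := eLpNorm_le_eLpNorm_mul_rpow_measure_univ (μ := μ) (f := fun r => f r ω)
      (p := 1) (q := ENNReal.ofReal m) (by simpa using hm) hfm.aestronglyMeasurable
    rw [eLpNorm_one_eq_lintegral_enorm,
      eLpNorm_eq_lintegral_rpow_enorm_toReal hp0 ENNReal.ofReal_ne_top,
      ENNReal.toReal_ofReal hm0.le] at h1
    calc ‖g ω‖ₑ ^ m ≤ _ := ENNReal.rpow_le_rpow ((hg ω).trans h1) hm0.le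
      _ = _ := by
        rw [ENNReal.mul_rpow_of_nonneg _ _ hm0.le, ← ENNReal.rpow_mul, ← ENNReal.rpow_mul]
        congr 2
        · rw [one_div_mul_cancel hm0.ne', ENNReal.rpow_one]
        · simp; field_simp
  rw [eLpNorm_eq_lintegral_rpow_enorm_toReal hp0 ENNReal.ofReal_ne_top,
      ENNReal.toReal_ofReal hm0.le]
  have hb : ∫⁻ ω, ‖g ω‖ₑ ^ m ∂P ≤ (A * μ Set.univ) ^ m := by
    calc ∫⁻ ω, ‖g ω‖ₑ ^ m ∂P
        ≤ ∫⁻ ω, (∫⁻ r, ‖f r ω‖ₑ ^ m ∂μ) * (μ Set.univ) ^ (m - 1) ∂P := lintegral_mono key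
      _ = (∫⁻ ω, ∫⁻ r, ‖f r ω‖ₑ ^ m ∂μ ∂P) * (μ Set.univ) ^ (m - 1) :=
          lintegral_mul_const' _ _
            (ENNReal.rpow_ne_top_of_nonneg (by linarith) (measure_ne_top _ _))
      _ = (∫⁻ r, ∫⁻ ω, ‖f r ω‖ₑ ^ m ∂P ∂μ) * (μ Set.univ) ^ (m - 1) := by
          rw [lintegral_lintegral_swap]
          apply Measurable.aemeasurable
          exact ((hf.comp measurable_swap).enorm).pow_const m
      _ ≤ (∫⁻ _, A ^ m ∂μ) * (μ Set.univ) ^ (m - 1) := by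
          gcongr ?_ * _
          apply lintegral_mono_ae
          filter_upwards [hA] with r hr
          rw [eLpNorm_eq_lintegral_rpow_enorm_toReal hp0 ENNReal.ofReal_ne_top,
            ENNReal.toReal_ofReal hm0.le] at hr
          rwa [one_div, ENNReal.rpow_inv_le_iff hm0] at hr
      _ = _ := by
          rw [lintegral_const, ENNReal.mul_rpow_of_nonneg _ _ hm0.le, mul_assoc]
          congr 1
          have e := ENNReal.rpow_add_of_nonneg (x := μ Set.univ) 1 (m - 1) (by norm_num)
            (by linarith)
          rw [ENNReal.rpow_one, add_sub_cancel] at e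
          exact e.symm
  rwa [one_div, ENNReal.rpow_inv_le_iff hm0]

lemma aux_max (u b b' : ℝ) (hu : 0 ≤ u) (hb₀ : 0 < b) (hb₁ : b < 1 / 2) (hb'₀ : 0 < b')
    (hb'₁ : b' < 1 / 2) : max (u ^ (2 * b)) (u ^ (2 * b')) ≤ (1 + u) ^ 2 := by
  have h : ∀ a : ℝ, 0 < a → a < 1 / 2 → u ^ (2 * a) ≤ (1 + u) ^ 2 := by
    intro a h0 h1
    calc u ^ (2 * a) ≤ (1 + u) ^ (2 * a) := Real.rpow_le_rpow hu (by linarith) (by linarith)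
      _ ≤ (1 + u) ^ (2 : ℝ) := Real.rpow_le_rpow_of_exponent_le (by linarith) (by linarith)
      _ = _ := by norm_cast
  exact max_le (h _ hb₀ hb₁) (h _ hb'₀ hb'₁)

lemma aux_incr {Ω : Type} [MeasurableSpace Ω] (P : Measure Ω) [IsProbabilityMeasure P]
    (Y : Ω → ℝ) (hY : Measurable Y) (σ m : ℝ) (hσ : 0 < σ) (hm : 1 ≤ m) (v : NNReal)
    (hv : Measure.map Y P = gaussianReal 0 v) (h2 : ∫ ω, Y ω ^ 2 ∂P ≤ σ ^ 2) :
    eLpNorm (fun ω => Y ω / σ) (ENNReal.ofReal m) P ≤ ENNReal.ofReal (2 * Real.sqrt m) := by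
  have hvσ : (v : ℝ) ≤ σ ^ 2 := by
    have h3 : ∫ ω, Y ω ^ 2 ∂P = v := by
      have e1 : ∫ x, x ^ 2 ∂(Measure.map Y P) = ∫ ω, Y ω ^ 2 ∂P :=
        integral_map hY.aemeasurable (by fun_prop)
      rw [← e1, hv]
      have e2 := variance_fun_id_gaussianReal (μ := 0) (v := v)
      rw [variance_of_integral_eq_zero (by fun_prop) integral_id_gaussianReal] at e2
      exact e2
    linarith
  have hmap : Measure.map (fun ω => Y ω / σ) P
      = gaussianReal 0 (v / ⟨σ ^ 2, sq_nonneg _⟩) := by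
    have e := gaussianReal_map_div_const (μ := 0) (v := v) σ
    rw [← hv, Measure.map_map (by fun_prop) hY, zero_div] at e
    exact e
  have := aux_gauss m hm (v / ⟨σ ^ 2, sq_nonneg _⟩) (by
    change (v : ℝ) / σ ^ 2 ≤ 1
    exact div_le_one_of_le₀ hvσ (sq_nonneg _))
  rw [← hmap, eLpNorm_map_measure (by fun_prop) (by fun_prop)] at this
  exact this

lemma aux_mass (lam t : ℝ) (hlam : 0 < lam) (ht : 0 ≤ t) :
    ∫ r in (0:ℝ)..t, lam * Real.exp (-lam * (t - r)) * (1 + |t - r|) ≤ 1 + 1 / lam := by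
  have e : ∫ r in (0:ℝ)..t, lam * Real.exp (-lam * (t - r)) * (1 + |t - r|)
      = ∫ r in (0:ℝ)..t, lam * Real.exp (-lam * (t - r)) * (1 + (t - r)) := by
    apply intervalIntegral.integral_congr
    intro r hr
    rw [Set.uIcc_of_le ht] at hr
    dsimp only
    rw [abs_of_nonneg (by linarith [hr.2])]
  rw [e, intervalIntegral.integral_eq_sub_of_hasDerivAt
    (f := fun r => Real.exp (-lam * (t - r)) * (1 + 1 / lam + (t - r)))]
  · simp
    positivity
  · intro r _
    have h0 : HasDerivAt (fun r : ℝ => t - r) (-1) r := by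
      simpa using (hasDerivAt_id r).const_sub t
    have h1 := (h0.const_mul (-lam)).exp.mul (h0.const_add (1 + 1 / lam))
    refine h1.congr_deriv ?_
    field_simp
    ring
  · apply Continuous.intervalIntegrable; fun_prop

/-- **Lemma B.1**: let `X` be a real-valued centered Gaussian process with continuous sample
paths, `X₀ = 0`, increment variance bounded by `(t-s)^{2β} ∨ (t-s)^{2β'}` and cross-covariance
of consecutive increments bounded by `K·((t-v)^β (v-s)^β ∨ (t-v)^{β'} (v-s)^{β'})`.  Then
there is `C = C(λ,β,β',K)` such that for all `m ≥ 1`,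
`sup_{t ≥ 0} ‖e^{-λt} X_t + λ ∫_0^t e^{-λ(t-r)} (X_t - X_r) dr‖_{L^m} ≤ C·√m`. -/
theorem gaussian_damped_integral_moment_bound (lam β β' K : ℝ)
    (hlam : 0 < lam) (hβ₀ : 0 < β) (hβ₁ : β < 1 / 2) (hβ'₀ : 0 < β') (hβ'₁ : β' < 1 / 2)
    (hK : 0 ≤ K) :
    ∃ C : ℝ, 0 < C ∧
      ∀ (Ω : Type) [MeasurableSpace Ω] (P : Measure Ω) [IsProbabilityMeasure P]
        (X : ℝ → Ω → ℝ),
        (∀ t : ℝ, Measurable (X t)) →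
        (∀ ω : Ω, ContinuousOn (fun t => X t ω) (Set.Ici 0)) →
        (∀ ω : Ω, X 0 ω = 0) →
        -- centered Gaussian process: every finite linear combination is centered Gaussian
        (∀ (n : ℕ) (c : Fin n → ℝ) (τ : Fin n → ℝ), (∀ k, 0 ≤ τ k) →
          ∃ v : NNReal,
            Measure.map (fun ω => ∑ k, c k * X (τ k) ω) P = gaussianReal 0 v) →
        -- increment variance bound
        (∀ s t : ℝ, 0 ≤ s → s < t →
          (∫ ω, (X t ω - X s ω) ^ 2 ∂P)
            ≤ max ((t - s) ^ (2 * β)) ((t - s) ^ (2 * β'))) →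
        -- cross-covariance bound for consecutive increments
        (∀ s v t : ℝ, 0 ≤ s → s < v → v < t →
          (∫ ω, (X t ω - X v ω) * (X v ω - X s ω) ∂P)
            ≤ K * max ((t - v) ^ β * (v - s) ^ β) ((t - v) ^ β' * (v - s) ^ β')) →
        ∀ m : ℝ, 1 ≤ m → ∀ t : ℝ, 0 ≤ t →
          eLpNorm
            (fun ω => Real.exp (-lam * t) * X t ω
              + lam * ∫ r in (0:ℝ)..t, Real.exp (-lam * (t - r)) * (X t ω - X r ω))
            (ENNReal.ofReal m) P
            ≤ ENNReal.ofReal (C * Real.sqrt m) := by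
  have hC : 0 < 1 + 1 / lam := by positivity
  refine ⟨4 * (1 + 1 / lam), by positivity, ?_⟩
  intro Ω _ P _ X hX hcont hX0 hG hvar _ m hm t ht
  have hinc : ∀ r, 0 ≤ r → r ≤ t → eLpNorm (fun ω => (X t ω - X r ω) / (1 + |t - r|))
      (ENNReal.ofReal m) P ≤ ENNReal.ofReal (2 * Real.sqrt m) := by
    intro r hr hrt
    rcases hrt.eq_or_lt with rfl | hlt
    · simp
    obtain ⟨v, hv⟩ := hG 2 ![1, -1] ![t, r] (by
      intro k; fin_cases k <;> simp [ht, hr])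
    have e : (fun ω => ∑ k : Fin 2, (![1, -1] : Fin 2 → ℝ) k * X ((![t, r] : Fin 2 → ℝ) k) ω)
        = fun ω => X t ω - X r ω := by
      funext ω; simp [Fin.sum_univ_two]; ring
    rw [e] at hv
    refine aux_incr P _ ((hX t).sub (hX r)) _ m (by positivity) hm v hv ?_
    rw [abs_of_pos (by linarith)]
    exact (hvar r t hr hlt).trans (aux_max _ _ _ (by linarith) hβ₀ hβ₁ hβ'₀ hβ'₁)
  let w : ℝ → ℝ := fun r => lam * Real.exp (-lam * (t - r)) * (1 + |t - r|)
  have hwc : Continuous w := by fun_prop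
  have hw0 : ∀ r, 0 ≤ w r := fun r => by positivity
  let μ : Measure ℝ := (volume.restrict (Set.Ioc 0 t)).withDensity fun r => ENNReal.ofReal (w r)
  have hμ : μ Set.univ ≤ ENNReal.ofReal (1 + 1 / lam) := by
    rw [withDensity_apply _ MeasurableSet.univ, Measure.restrict_univ,
      ← ofReal_integral_eq_lintegral_ofReal]
    · apply ENNReal.ofReal_le_ofReal
      rw [← intervalIntegral.integral_of_le ht]
      exact aux_mass lam t hlam ht
    · exact (hwc.integrableOn_Icc).mono_set Set.Ioc_subset_Icc_self
    · exact Filter.Eventually.of_forall hw0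
  have : IsFiniteMeasure μ := ⟨hμ.trans_lt ENNReal.ofReal_lt_top⟩
  let f : ℝ → Ω → ℝ := fun r ω => (X t ω - X (max r 0) ω) / (1 + |t - r|)
  have hXm : Measurable (Function.uncurry fun r ω => X (max r 0) ω) := by
    apply measurable_uncurry_of_continuous_of_measurable
    · intro ω
      exact (hcont ω).comp_continuous (by fun_prop) fun r => le_max_right r 0
    · intro r; exact hX _
  have hf : Measurable (Function.uncurry f) := by
    refine Measurable.div (((hX t).comp measurable_snd).sub hXm) ?_
    fun_prop
  let g : Ω → ℝ := fun ω => lam * ∫ r in (0:ℝ)..t, Real.exp (-lam * (t - r)) * (X t ω - X r ω)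
  have hgm : Measurable g := by
    have e : g = fun ω => lam * ∫ r, Real.exp (-lam * (t - r)) * (X t ω - X (max r 0) ω)
        ∂(volume.restrict (Set.Ioc 0 t)) := by
      funext ω
      simp only [g]
      rw [intervalIntegral.integral_of_le ht]
      congr 1
      apply setIntegral_congr_fun measurableSet_Ioc
      intro r hr
      simp only [max_eq_left hr.1.le]
    rw [e]
    apply Measurable.const_mul
    have hj : Measurable (fun p : Ω × ℝ =>
        Real.exp (-lam * (t - p.2)) * (X t p.1 - X (max p.2 0) p.1)) := by
      refine Measurable.mul (by fun_prop) (((hX t).comp measurable_fst).sub ?_)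
      exact hXm.comp measurable_swap
    exact (hj.stronglyMeasurable.integral_prod_right
      (ν := volume.restrict (Set.Ioc 0 t))).measurable
  have h2 : eLpNorm g (ENNReal.ofReal m) P ≤ ENNReal.ofReal (2 * Real.sqrt m) * μ Set.univ := by
    refine aux_mink P μ f hf g m hm _ ?_ ?_
    · have hac : μ ≪ volume.restrict (Set.Ioc 0 t) := withDensity_absolutelyContinuous _ _
      apply hac.ae_le
      filter_upwards [ae_restrict_mem measurableSet_Ioc] with r hr
      simp only [f, max_eq_left hr.1.le]
      exact hinc r hr.1.le hr.2
    · intro ω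
      have hfm : Measurable (fun r => f r ω) := hf.comp (by fun_prop : Measurable fun r => (r, ω))
      rw [lintegral_withDensity_eq_lintegral_mul _ (by fun_prop) hfm.enorm]
      simp only [g]
      rw [← intervalIntegral.integral_const_mul, intervalIntegral.integral_of_le ht]
      refine (enorm_integral_le_lintegral_enorm _).trans (le_of_eq ?_)
      apply setLIntegral_congr_fun measurableSet_Ioc
      intro r hr
      simp only [Pi.mul_apply, f, max_eq_left hr.1.le]
      have hpos : 0 < 1 + |t - r| := by positivity
      rw [← Real.enorm_of_nonneg (hw0 r), ← enorm_mul]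
      congr 1
      simp only [w]
      field_simp
  have h1 : eLpNorm (fun ω => Real.exp (-lam * t) * X t ω) (ENNReal.ofReal m) P
      ≤ ENNReal.ofReal (1 + 1 / lam) * ENNReal.ofReal (2 * Real.sqrt m) := by
    have e : (fun ω => Real.exp (-lam * t) * X t ω)
        = (Real.exp (-lam * t) * (1 + |t - 0|)) •
            (fun ω => (X t ω - X 0 ω) / (1 + |t - 0|)) := by
      funext ω
      have hpos : 0 < 1 + |t - 0| := by positivity
      simp only [Pi.smul_apply, smul_eq_mul, hX0 ω]
      field_simp
      ring
    rw [e, eLpNorm_const_smul]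
    gcongr
    · rw [Real.enorm_of_nonneg (by positivity)]
      apply ENNReal.ofReal_le_ofReal
      rw [sub_zero, abs_of_nonneg ht, neg_mul, Real.exp_neg, inv_mul_le_iff₀ (Real.exp_pos _)]
      have h3 := Real.add_one_le_exp (lam * t)
      have h4 : lam * t * (1 / lam) = t := by field_simp
      have h5 : 0 < 1 / lam := by positivity
      nlinarith [mul_nonneg hlam.le ht]
    · exact hinc 0 le_rfl ht
  calc _ ≤ eLpNorm (fun ω => Real.exp (-lam * t) * X t ω) (ENNReal.ofReal m) P
        + eLpNorm g (ENNReal.ofReal m) P :=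
        eLpNorm_add_le ((hX t).const_mul _).aestronglyMeasurable hgm.aestronglyMeasurable
          (by simpa using hm)
    _ ≤ ENNReal.ofReal (1 + 1 / lam) * ENNReal.ofReal (2 * Real.sqrt m)
        + ENNReal.ofReal (2 * Real.sqrt m) * ENNReal.ofReal (1 + 1 / lam) := by
        gcongr
        exact h2.trans (by gcongr)
    _ = _ := by
        rw [← ENNReal.ofReal_mul hC.le, ← ENNReal.ofReal_mul (by positivity),
          ← ENNReal.ofReal_add (by positivity) (by positivity)]
        congr 1; ring
end

section
/- Let H ∈ (0,1), γ ∈ (0,H), δ ∈ (H−γ, 1−γ) and d ≥ 1. There exists an ℝ^d-valued centered Gaussian process (W_t)_{t ≤ 0} with continuous sample paths and covariance E[W_t^i W_s^j] = δ_{ij}·(1/2)·(|t|^{2H} + |s|^{2H} − |t−s|^{2H}) for s, t ≤ 0 (in particular W_0 = 0 almost surely), such that almost surely ‖W‖_{γ,δ} := sup_{s,t ≤ 0, s ≠ t} |W_t − W_s| / (|t−s|^γ·(1+|t|+|s|)^δ) < ∞. -/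
open MeasureTheory ProbabilityTheory


lemma aux_lip {Ω : Type*} [MeasurableSpace Ω] (P : Measure Ω) [IsProbabilityMeasure P] (t : ℝ) :
    Continuous (fun f : Lp ℝ 2 P => ∫ ω, Complex.exp (t * f ω * Complex.I) ∂P) := by
  have hIntg : ∀ f : Lp ℝ 2 P, Integrable (fun ω => Complex.exp (t * f ω * Complex.I)) P := by
    intro f
    refine Integrable.of_bound (C := 1) ?_ ?_
    · have := (Lp.aestronglyMeasurable f)
      have h2 : Continuous (fun x : ℝ => Complex.exp (t * x * Complex.I)) := by fun_prop
      exact h2.comp_aestronglyMeasurable this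
    · refine Filter.Eventually.of_forall fun ω => ?_
      have : (t * f ω * Complex.I : ℂ) = ((t * f ω : ℝ) : ℂ) * Complex.I := by push_cast; ring
      rw [this, Complex.norm_exp_ofReal_mul_I]
  have : LipschitzWith (Real.toNNReal |t|)
      (fun f : Lp ℝ 2 P => ∫ ω, Complex.exp (t * f ω * Complex.I) ∂P) := by
    refine LipschitzWith.of_dist_le_mul fun f g => ?_
    rw [dist_eq_norm, dist_eq_norm, ← integral_sub (hIntg f) (hIntg g), Real.coe_toNNReal _ (abs_nonneg t)]
    have hL2 : MemLp (f - g : Lp ℝ 2 P) 2 P := Lp.memLp _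
    have hL1 : Integrable (f - g : Lp ℝ 2 P) P := hL2.integrable (by norm_num)
    calc ‖∫ ω, (Complex.exp (t * f ω * Complex.I) - Complex.exp (t * g ω * Complex.I)) ∂P‖
        ≤ ∫ ω, ‖Complex.exp (t * f ω * Complex.I) - Complex.exp (t * g ω * Complex.I)‖ ∂P :=
          norm_integral_le_integral_norm _
      _ ≤ ∫ ω, |t| * ‖(f - g : Lp ℝ 2 P) ω‖ ∂P := by
          refine integral_mono_ae ((hIntg f).sub (hIntg g)).norm (hL1.norm.const_mul _) ?_
          filter_upwards [Lp.coeFn_sub f g] with ω hω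
          rw [hω]
          have : Complex.exp (t * f ω * Complex.I) - Complex.exp (t * g ω * Complex.I)
            = Complex.exp (((t * g ω : ℝ):ℂ) * Complex.I) *
              (Complex.exp (Complex.I * ((t * (f ω - g ω) : ℝ):ℂ)) - 1) := by
            rw [mul_sub, ← Complex.exp_add]; push_cast; ring_nf
          simp only [this, norm_mul, Complex.norm_exp_ofReal_mul_I, one_mul]
          refine (Real.norm_exp_I_mul_ofReal_sub_one_le).trans ?_
          rw [norm_mul]; rfl
      _ = |t| * ∫ ω, ‖(f - g : Lp ℝ 2 P) ω‖ ∂P := integral_const_mul _ _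
      _ ≤ |t| * ‖f - g‖ := by
          gcongr
          rw [Lp.norm_def, integral_norm_eq_lintegral_enorm hL1.1, ← eLpNorm_one_eq_lintegral_enorm]
          exact ENNReal.toReal_mono hL2.eLpNorm_ne_top
            (eLpNorm_le_eLpNorm_of_exponent_le (by norm_num) hL2.1)
  exact this.continuous

lemma isonormal (𝓗 : Type) [NormedAddCommGroup 𝓗] [InnerProductSpace ℝ 𝓗] [CompleteSpace 𝓗] :
    ∃ (Ω : Type) (_ : MeasurableSpace Ω) (P : Measure Ω) (_ : IsProbabilityMeasure P)
      (J : 𝓗 →ₗᵢ[ℝ] Lp ℝ 2 P), ∀ h, Measure.map (J h) P = gaussianReal 0 (‖h‖₊ ^ 2) := by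
  classical
  obtain ⟨w, b, hb⟩ := exists_hilbertBasis ℝ 𝓗
  obtain ⟨Ω, mΩ, P, ξ, hm, hlaw, hind, hP⟩ := exists_iid w (gaussianReal 0 1)
  refine ⟨Ω, mΩ, P, hP, ?_⟩
  have hL : ∀ i, MemLp (ξ i) 2 P := fun i => (hlaw i).hasGaussianLaw.memLp_two
  let e : w → Lp ℝ 2 P := fun i => (hL i).toLp (ξ i)
  have hmean : ∀ i, ∫ ω, ξ i ω ∂P = 0 := fun i => by
    rw [(hlaw i).integral_eq, integral_id_gaussianReal]
  have hvar : ∀ i, ∫ ω, ξ i ω ^ 2 ∂P = 1 := fun i => by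
    have := (hlaw i).variance_eq
    rw [variance_id_gaussianReal, variance_of_integral_eq_zero (hm i).aemeasurable (hmean i)] at this
    simpa using this
  have hin : ∀ i j, inner ℝ (e i) (e j) = ∫ ω, ξ i ω * ξ j ω ∂P := fun i j => by
    rw [L2.inner_def]
    refine integral_congr_ae ?_
    filter_upwards [(hL i).coeFn_toLp, (hL j).coeFn_toLp] with ω h1 h2
    simp only [e]
    rw [h1, h2]; simp [mul_comm]
  have he : Orthonormal ℝ e := by
    rw [orthonormal_iff_ite]
    intro i j
    rw [hin]
    split_ifs with h
    · subst h; simpa [sq] using hvar i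
    · rw [(hind.indepFun h).integral_fun_mul_eq_mul_integral (hm i).aestronglyMeasurable
        (hm j).aestronglyMeasurable, hmean, zero_mul]
  let J : 𝓗 →ₗᵢ[ℝ] Lp ℝ 2 P := he.orthogonalFamily.linearIsometry.comp b.repr.toLinearIsometry
  have hJb : ∀ i, J (b i) = e i := by
    intro i
    change he.orthogonalFamily.linearIsometry (b.repr (b i)) = e i
    rw [b.repr_self, OrthogonalFamily.linearIsometry_apply_single]
    simp
  refine ⟨J, fun h => ?_⟩
  -- Gaussian on the span
  have hspan : ∀ h ∈ Submodule.span ℝ (Set.range b), HasGaussianLaw (J h) P ∧ ∫ ω, J h ω ∂P = 0 := by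
    intro h hh
    rw [Finsupp.mem_span_range_iff_exists_finsupp] at hh
    obtain ⟨c, rfl⟩ := hh
    have h1 : J (c.sum fun i a => a • b i) = ∑ i ∈ c.support, c i • e i := by
      simp [Finsupp.sum, hJb]
    have h2 : HasGaussianLaw (fun ω => ∑ i : c.support, c i * ξ i ω) P := by
      refine iIndepFun.hasGaussianLaw_fun_sum (X := fun (i : c.support) ω => c i * ξ i ω) ?_ ?_
      · intro i
        exact (hlaw i).hasGaussianLaw.fun_smul (c i)
      · have := hind.precomp (g := fun i : c.support => (i : w)) Subtype.val_injective
        exact this.comp (fun i x => c i * x) (fun i => by fun_prop)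
    have h3 : ∀ᵐ ω ∂P, ∀ i : c.support, (c i • e i : Lp ℝ 2 P) ω = c i * ξ i ω := by
      rw [ae_all_iff]; intro i
      filter_upwards [Lp.coeFn_smul (c i) (e i), (hL i).coeFn_toLp] with ω h4 h5
      rw [h4]; simp [e, h5]
    have h6 : (fun ω => ∑ i : c.support, c i * ξ i ω) =ᵐ[P] J (c.sum fun i a => a • b i) := by
      rw [h1]
      filter_upwards [h3, Lp.coeFn_finsetSum c.support (fun i => c i • e i)] with ω h4 h5
      rw [h5, ← Finset.sum_coe_sort c.support]
      simp [h4]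
    refine ⟨h2.congr h6, ?_⟩
    rw [← integral_congr_ae h6, integral_finsetSum]
    · simp [integral_const_mul, hmean]
    · intro i _
      exact ((hL i).integrable (by norm_num)).const_mul _
  have hcf : ∀ t : ℝ, ∀ h, ∫ ω, Complex.exp (t * J h ω * Complex.I) ∂P
      = Complex.exp (- (‖h‖ ^ 2 * t ^ 2 / 2 : ℝ)) := by
    intro t
    have hd : Dense (Submodule.span ℝ (Set.range b) : Set 𝓗) :=
      Submodule.dense_iff_topologicalClosure_eq_top.2 b.dense_span
    have hc2 : Continuous (fun h : 𝓗 => Complex.exp (- (‖h‖ ^ 2 * t ^ 2 / 2 : ℝ))) := by fun_prop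
    refine congrFun (Continuous.ext_on hd ((aux_lip P t).comp J.continuous) hc2
      (fun h hh => ?_))
    obtain ⟨hg, hm0⟩ := hspan h hh
    have hmap := hg.map_eq_gaussianReal
    rw [hm0, variance_of_integral_eq_zero (Lp.aestronglyMeasurable _).aemeasurable hm0] at hmap
    have hv : ∫ ω, (J h ω) ^ 2 ∂P = ‖h‖ ^ 2 := by
      rw [← J.norm_map h, ← real_inner_self_eq_norm_sq, L2.inner_def]
      simp [sq]
    have hch := charFun_gaussianReal (μ := 0) (v := (∫ ω, (J h ω) ^ 2 ∂P).toNNReal) t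
    rw [← hmap, charFun_apply_real, integral_map (Lp.aestronglyMeasurable _).aemeasurable
      (by fun_prop)] at hch
    refine Eq.trans hch ?_
    rw [hv, Real.coe_toNNReal _ (by positivity)]
    push_cast
    congr 1; ring
  have : IsProbabilityMeasure (P.map (J h)) :=
    Measure.isProbabilityMeasure_map (Lp.aestronglyMeasurable _).aemeasurable
  refine Measure.ext_of_charFun ?_
  ext t
  rw [charFun_gaussianReal, charFun_apply_real,
    integral_map (Lp.aestronglyMeasurable _).aemeasurable (by fun_prop), hcf]
  push_cast
  congr 1; ring


lemma aux_int (H : ℝ) (h0 : 0 < H) (h1 : H < 1) (u : ℝ) :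
    IntegrableOn (fun x : ℝ => (2 * Real.sin (u * x / 2)) ^ 2 * x ^ (-(2 * H + 1))) (Set.Ioi 0) := by
  have hmeas : ∀ s, MeasurableSet s → AEStronglyMeasurable 
    (fun x : ℝ => (2 * Real.sin (u * x / 2)) ^ 2 * x ^ (-(2 * H + 1))) (volume.restrict s) := by
    intro s _
    exact Measurable.aestronglyMeasurable (by fun_prop)
  rw [← Set.Ioc_union_Ioi_eq_Ioi (zero_le_one (α := ℝ))]
  refine IntegrableOn.union ?_ ?_
  · have : IntegrableOn (fun x : ℝ => u ^ 2 * x ^ (1 - 2 * H)) (Set.Ioc 0 1) := by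
      refine Integrable.const_mul ?_ _
      have := intervalIntegral.intervalIntegrable_rpow' (a := 0) (b := 1) (r := 1 - 2 * H) (by linarith)
      rwa [intervalIntegrable_iff_integrableOn_Ioc_of_le zero_le_one] at this
    refine Integrable.mono' this (hmeas _ measurableSet_Ioc) ?_
    filter_upwards [ae_restrict_mem measurableSet_Ioc] with x hx
    have hx0 : 0 < x := hx.1
    rw [Real.norm_of_nonneg (by positivity)]
    have e1 : x ^ (1 - 2 * H) = x ^ 2 * x ^ (-(2 * H + 1)) := by
      rw [← Real.rpow_natCast x 2, ← Real.rpow_add hx0]; congr 1; push_cast; ring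
    rw [e1, ← mul_assoc]
    gcongr
    rw [← mul_pow]
    refine sq_le_sq.2 ?_
    have h3 := Real.norm_exp_I_mul_ofReal_sub_one_le (x := u * x)
    rwa [Complex.norm_exp_I_mul_ofReal_sub_one] at h3
  · have : IntegrableOn (fun x : ℝ => 4 * x ^ (-(2 * H + 1))) (Set.Ioi 1) :=
      Integrable.const_mul (integrableOn_Ioi_rpow_of_lt (by linarith) one_pos) _
    refine Integrable.mono' this (hmeas _ measurableSet_Ioi) ?_
    filter_upwards [ae_restrict_mem measurableSet_Ioi] with x hx
    have hx0 : 0 < x := lt_trans one_pos hx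
    rw [Real.norm_of_nonneg (by positivity)]
    gcongr
    nlinarith [Real.sin_sq_le_one (u * x / 2)]

lemma aux_scale (H : ℝ) (h0 : 0 < H) (u : ℝ) :
    ∫ x in Set.Ioi (0:ℝ), (2 * Real.sin (u * x / 2)) ^ 2 * x ^ (-(2 * H + 1))
     = |u| ^ (2 * H) * ∫ x in Set.Ioi (0:ℝ), (2 * Real.sin (x / 2)) ^ 2 * x ^ (-(2 * H + 1)) := by
  rcases eq_or_ne u 0 with rfl | hu
  · simp [Real.zero_rpow (by positivity : 2 * H ≠ 0)]
  have hu' : 0 < |u| := abs_pos.2 hu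
  have h := integral_comp_mul_left_Ioi' (fun x : ℝ => (2 * Real.sin (x / 2)) ^ 2 * x ^ (-(2 * H + 1))) 0 hu'
  rw [mul_zero] at h
  rw [← h, smul_eq_mul, ← mul_assoc, ← integral_const_mul]
  refine setIntegral_congr_fun measurableSet_Ioi fun x hx => ?_
  have hx0 : (0:ℝ) < x := hx
  rw [Real.mul_rpow hu'.le hx0.le]
  have e1 : |u| ^ (2 * H) * |u| * |u| ^ (-(2 * H + 1)) = 1 := by
    rw [← Real.rpow_add_one hu'.ne', ← Real.rpow_add hu']; simp
  have e2 : (2 * Real.sin (|u| * x / 2)) ^ 2 = (2 * Real.sin (u * x / 2)) ^ 2 := by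
    rcases abs_choice u with h | h <;> rw [h]
    rw [neg_mul, neg_div, Real.sin_neg]; ring
  rw [e2]
  linear_combination (-(2 * Real.sin (u * x / 2)) ^ 2 * x ^ (-(2 * H + 1))) * e1

lemma aux_pos (H : ℝ) (h0 : 0 < H) (h1 : H < 1) :
    0 < ∫ x in Set.Ioi (0:ℝ), (2 * Real.sin (x / 2)) ^ 2 * x ^ (-(2 * H + 1)) := by
  have hi := aux_int H h0 h1 1
  simp only [one_mul] at hi
  rw [setIntegral_pos_iff_support_of_nonneg_ae _ hi]
  · refine lt_of_lt_of_le ?_ (measure_mono (s := Set.Ioo (0:ℝ) 1) ?_)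
    · simp
    · intro x hx
      refine ⟨?_, hx.1⟩
      have hx0 : 0 < x := hx.1
      have : 0 < Real.sin (x / 2) := Real.sin_pos_of_pos_of_lt_pi (by linarith) (by linarith [hx.2, Real.pi_gt_three])
      exact ne_of_gt (by positivity)
  · filter_upwards [ae_restrict_mem measurableSet_Ioi] with x hx
    have hx0 : (0:ℝ) < x := hx
    simp only [Pi.zero_apply]
    positivity

lemma fbm_curve (H : ℝ) (h0 : 0 < H) (h1 : H < 1) :
    ∃ φ : ℝ → Lp ℂ 2 (volume.restrict (Set.Ioi (0:ℝ))), φ 0 = 0 ∧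
      ∀ s t, ‖φ t - φ s‖ ^ 2 = |t - s| ^ (2 * H) := by
  set μ := volume.restrict (Set.Ioi (0:ℝ)) with hμ
  let g : ℝ → ℝ → ℂ := fun t x => (Complex.exp (Complex.I * ((t * x : ℝ) : ℂ)) - 1) * ((x ^ (-(H + 1/2)) : ℝ) : ℂ)
  have hsq : ∀ s t x, 0 < x → ‖g t x - g s x‖ ^ 2 = (2 * Real.sin ((t - s) * x / 2)) ^ 2 * x ^ (-(2 * H + 1)) := by
    intro s t x hx
    have : g t x - g s x = Complex.exp (((s * x : ℝ):ℂ) * Complex.I) *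
        ((Complex.exp (Complex.I * (((t - s) * x : ℝ) : ℂ)) - 1) * ((x ^ (-(H + 1/2)) : ℝ) : ℂ)) := by
      have : Complex.exp (Complex.I * ((t * x : ℝ) : ℂ)) = Complex.exp (((s * x : ℝ):ℂ) * Complex.I) * Complex.exp (Complex.I * (((t - s) * x : ℝ) : ℂ)) := by
        rw [← Complex.exp_add]; congr 1; push_cast; ring
      simp only [g]
      rw [this, mul_comm Complex.I ((s * x : ℝ):ℂ)]; ring
    rw [this, norm_mul, norm_mul, Complex.norm_exp_ofReal_mul_I, Complex.norm_exp_I_mul_ofReal_sub_one, 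
      one_mul, mul_pow, Complex.norm_real, Real.norm_eq_abs, sq_abs, Real.norm_eq_abs, sq_abs, ← Real.rpow_natCast (x ^ _), ← Real.rpow_mul hx.le]
    congr 2; push_cast; ring
  have hg0 : ∀ x, g 0 x = 0 := fun x => by simp [g]
  have hmeas : ∀ t, AEStronglyMeasurable (g t) μ := fun t =>
    Measurable.aestronglyMeasurable (by fun_prop)
  have hL : ∀ t, MemLp (g t) 2 μ := by
    intro t
    rw [memLp_two_iff_integrable_sq_norm (hmeas t)]
    refine (aux_int H h0 h1 t).congr ?_
    filter_upwards [ae_restrict_mem measurableSet_Ioi] with x hx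
    have := hsq 0 t x hx
    rw [hg0, sub_zero, sub_zero] at this
    exact this.symm
  set K := ∫ x in Set.Ioi (0:ℝ), (2 * Real.sin (x / 2)) ^ 2 * x ^ (-(2 * H + 1)) with hK
  have hKpos : 0 < K := aux_pos H h0 h1
  let ψ : ℝ → Lp ℂ 2 μ := fun t => (hL t).toLp (g t)
  have hψ : ∀ s t, ‖ψ t - ψ s‖ ^ 2 = |t - s| ^ (2 * H) * K := by
    intro s t
    rw [hK, ← aux_scale H h0, ← real_inner_self_eq_norm_sq, L2.inner_def]
    refine integral_congr_ae ?_
    filter_upwards [Lp.coeFn_sub (ψ t) (ψ s), (hL s).coeFn_toLp, (hL t).coeFn_toLp, ae_restrict_mem measurableSet_Ioi] with x h1 h2 h3 hx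
    rw [← hsq s t x hx, real_inner_self_eq_norm_sq, h1, Pi.sub_apply, h2, h3]
  refine ⟨fun t => (Real.sqrt K)⁻¹ • (ψ t - ψ 0), by simp, fun s t => ?_⟩
  rw [← smul_sub, sub_sub_sub_cancel_right, norm_smul, mul_pow, hψ, norm_inv, inv_pow,
    Real.norm_eq_abs, sq_abs, Real.sq_sqrt hKpos.le]
  field_simp


lemma wsum_bound (H γ δ : ℝ) (hδ : 0 < δ) (p : ℕ)
    (h1 : 2 ≤ δ * p) (h2 : 3 ≤ (H - γ) * p) (h3 : 1 ≤ (γ + δ - H) * p)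
    (y u : ℝ) (hy : 0 < y) (hu : 1 ≤ u) :
    (y ^ H / (y ^ γ * (1 + u * y) ^ δ)) ^ p ≤ min y y⁻¹ * (u ^ 2)⁻¹ := by
  have hu0 : 0 < u := by linarith
  have huy : 0 < u * y := by positivity
  have e : (y ^ H / (y ^ γ * (1 + u * y) ^ δ)) ^ p
      = y ^ ((H - γ) * p) * ((1 + u * y) ^ (δ * p))⁻¹ := by
    rw [← div_div, ← Real.rpow_sub hy, div_pow, ← Real.rpow_natCast, ← Real.rpow_natCast (_ ^ δ),
      ← Real.rpow_mul hy.le, ← Real.rpow_mul (by positivity), div_eq_mul_inv]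
  rw [e]
  rcases le_total y 1 with hy1 | hy1
  · have m : min y y⁻¹ = y := min_eq_left (hy1.trans ((one_le_inv₀ hy).2 hy1))
    rw [m]
    have a1 : y ^ ((H - γ) * p) ≤ y ^ (3:ℝ) := Real.rpow_le_rpow_of_exponent_ge hy hy1 h2
    have a2 : (u * y) ^ (2:ℝ) ≤ (1 + u * y) ^ (δ * p) :=
      (Real.rpow_le_rpow huy.le (by linarith) (by norm_num)).trans
        (Real.rpow_le_rpow_of_exponent_le (by linarith) h1)
    have a3 : ((1 + u * y) ^ (δ * p))⁻¹ ≤ ((u * y) ^ (2:ℝ))⁻¹ := by gcongr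
    calc _ ≤ y ^ (3:ℝ) * ((u * y) ^ (2:ℝ))⁻¹ := by gcongr
      _ = _ := by
        norm_cast
        field_simp
  · have m : min y y⁻¹ = y⁻¹ := min_eq_right ((inv_le_one_of_one_le₀ hy1).trans hy1)
    rw [m]
    have a2 : (u * y) ^ (δ * p) ≤ (1 + u * y) ^ (δ * p) :=
      Real.rpow_le_rpow huy.le (by linarith) (by linarith)
    have a4 : u ^ (2:ℝ) ≤ u ^ (δ * p) := Real.rpow_le_rpow_of_exponent_le hu h1
    have a5 : y ^ ((H - γ) * p) * (y ^ (δ * p))⁻¹ ≤ y⁻¹ := by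
      rw [← Real.rpow_neg hy.le, ← Real.rpow_add hy, ← Real.rpow_neg_one]
      apply Real.rpow_le_rpow_of_exponent_le hy1
      linarith
    calc y ^ ((H - γ) * p) * ((1 + u * y) ^ (δ * p))⁻¹
        ≤ y ^ ((H - γ) * p) * ((u * y) ^ (δ * p))⁻¹ := by gcongr
      _ = (y ^ ((H - γ) * p) * (y ^ (δ * p))⁻¹) * (u ^ (δ * p))⁻¹ := by
        rw [Real.mul_rpow hu0.le hy.le, mul_inv]; ring
      _ ≤ y⁻¹ * (u ^ (2:ℝ))⁻¹ := by gcongr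
      _ = _ := by norm_cast

lemma wsum_summable : Summable (fun q : ℤ × ℕ => min ((2:ℝ) ^ q.1) ((2:ℝ) ^ q.1)⁻¹ * (((q.2 : ℝ) + 1) ^ 2)⁻¹) := by
  have s1 : Summable (fun n : ℤ => min ((2:ℝ) ^ n) ((2:ℝ) ^ n)⁻¹) := by
    have hg : Summable (fun n : ℕ => ((1:ℝ)/2) ^ n) := summable_geometric_two
    refine Summable.of_nat_of_neg ?_ ?_
    · refine Summable.of_nonneg_of_le (fun n => by positivity) (fun n => ?_) hg
      refine (min_le_right _ _).trans ?_
      simp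
    · refine Summable.of_nonneg_of_le (fun n => by positivity) (fun n => ?_) hg
      refine (min_le_left _ _).trans ?_
      simp
  have s2 : Summable (fun j : ℕ => (((j : ℝ) + 1) ^ 2)⁻¹) := by
    have := (summable_nat_add_iff 1).2 (Real.summable_nat_pow_inv.2 (show 1 < 2 by norm_num))
    simpa using this
  exact Summable.mul_of_nonneg s1 s2 (fun n => by positivity) (fun n => by positivity)

lemma gauss_moment {Ω : Type*} [MeasurableSpace Ω] (P : Measure Ω) (p : ℕ) :
   ∃ m : ENNReal, m ≠ ⊤ ∧ ∀ (D : Ω → ℝ) (σ : ℝ), Measurable D → 0 ≤ σ →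
     P.map D = gaussianReal 0 (.mk (σ ^ 2) (sq_nonneg _)) → 
     ∫⁻ ω, ENNReal.ofReal (|D ω| ^ p) ∂P = ENNReal.ofReal (σ ^ p) * m := by
  refine ⟨∫⁻ x, ENNReal.ofReal (|x| ^ p) ∂(gaussianReal 0 1), ?_, ?_⟩
  · have h := (memLp_id_gaussianReal (μ := 0) (v := 1) p).integrable_norm_pow'
    have := h.lintegral_lt_top
    exact this.ne
  · intro D σ hD hσ hmap
    have hm : Measurable (fun x : ℝ => ENNReal.ofReal (|x| ^ p)) := by fun_prop
    rw [← lintegral_map (f := fun x : ℝ => ENNReal.ofReal (|x| ^ p)) hm hD, hmap]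
    have := gaussianReal_map_const_mul (μ := 0) (v := 1) σ
    rw [mul_zero, mul_one] at this
    rw [← this, lintegral_map hm (by fun_prop), ← lintegral_const_mul _ hm]
    congr 1 with x
    rw [abs_mul, mul_pow, abs_of_nonneg hσ, ENNReal.ofReal_mul (by positivity)]

lemma chain_one (γ δ K : ℝ) (hδ : 0 < δ) (hK0 : 0 ≤ K) (f : ℝ → ℝ)
    (hK : ∀ (n : ℤ) (j : ℕ), |f ((j + 1) * 2 ^ n) - f (j * 2 ^ n)|
      ≤ K * (((2:ℝ) ^ n) ^ γ * (1 + (j + 1) * 2 ^ n) ^ δ)) (n : ℤ) (m : ℕ) :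
    ∀ i : ℕ, |f (i * 2 ^ (n - m)) - f (((i / 2 ^ m : ℕ) : ℝ) * 2 ^ n)|
      ≤ K * (((2:ℝ) ^ n) ^ γ * (1 + i * 2 ^ (n - m)) ^ δ) * ∑ l ∈ Finset.range m, ((2:ℝ) ^ (-γ)) ^ (l + 1) := by
  induction m with
  | zero => intro i; simp
  | succ m ih =>
    intro i
    have e0 : i / 2 ^ (m + 1) = (i / 2) / 2 ^ m := by
      rw [Nat.div_div_eq_div_mul, pow_succ, mul_comm]
    have e1 : (2:ℝ) ^ (n - m) = 2 * 2 ^ (n - (m + 1 : ℕ)) := by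
      rw [← zpow_one_add₀ (by norm_num)]; congr 1; push_cast; ring
    have hz : (0:ℝ) < 2 ^ (n - (m + 1 : ℕ)) := by positivity
    have e2 : ((2:ℝ) ^ (n - (m + 1 : ℕ))) ^ γ = ((2:ℝ) ^ n) ^ γ * ((2:ℝ) ^ (-γ)) ^ (m + 1) := by
      rw [← Real.rpow_intCast, ← Real.rpow_intCast, ← Real.rpow_natCast, ← Real.rpow_mul (by norm_num),
        ← Real.rpow_mul (by norm_num), ← Real.rpow_mul (by norm_num), ← Real.rpow_add (by norm_num)]
      congr 1; push_cast; ring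
    have ihi := ih (i / 2)
    rw [e1] at ihi
    set z : ℝ := 2 ^ (n - (m + 1 : ℕ)) with hzdef
    set y : ℝ := (2:ℝ) ^ n with hy
    have hy0 : 0 < y := by positivity
    have hle : ((i / 2 : ℕ) : ℝ) * (2 * z) ≤ i * z := by
      have : ((i / 2 : ℕ) : ℝ) * 2 ≤ i := by exact_mod_cast Nat.div_mul_le_self i 2
      nlinarith
    have hstep : |f (i * z) - f (((i / 2 : ℕ) : ℝ) * (2 * z))| ≤
        K * (y ^ γ * (1 + i * z) ^ δ) * ((2:ℝ) ^ (-γ)) ^ (m + 1) := by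
      rcases Nat.even_or_odd' i with ⟨k, rfl | rfl⟩
      · have : ((2 * k / 2 : ℕ) : ℝ) * (2 * z) = ((2 * k : ℕ) : ℝ) * z := by
          rw [Nat.mul_div_cancel_left _ (by norm_num)]; push_cast; ring
        rw [this, sub_self, abs_zero]
        positivity
      · have h3 : (2 * k + 1) / 2 = k := by omega
        have h2 := hK (n - (m + 1 : ℕ)) (2 * k)
        rw [← hzdef, e2] at h2
        rw [h3]
        have e4 : (k:ℝ) * (2 * z) = ((2 * k : ℕ) : ℝ) * z := by push_cast; ring
        have e5 : ((2 * k + 1 : ℕ) : ℝ) = ((2 * k : ℕ) : ℝ) + 1 := by push_cast; ring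
        rw [e4, e5]
        refine h2.trans (le_of_eq ?_)
        ring
    have hmono : (1 + ((i / 2 : ℕ) : ℝ) * (2 * z)) ^ δ ≤ (1 + i * z) ^ δ := by
      apply Real.rpow_le_rpow _ _ hδ.le
      · positivity
      · linarith
    rw [e0, Finset.sum_range_succ, mul_add]
    have := abs_sub_le (f (i * z)) (f (((i / 2 : ℕ) : ℝ) * (2 * z))) (f (((i / 2 / 2 ^ m : ℕ) : ℝ) * y))
    have h7 : K * (y ^ γ * (1 + ((i / 2 : ℕ) : ℝ) * (2 * z)) ^ δ) * ∑ l ∈ Finset.range m, ((2:ℝ) ^ (-γ)) ^ (l + 1)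
      ≤ K * (y ^ γ * (1 + i * z) ^ δ) * ∑ l ∈ Finset.range m, ((2:ℝ) ^ (-γ)) ^ (l + 1) := by
      gcongr
    linarith

lemma chain_two (γ δ : ℝ) (hγ : 0 < γ) (hδ : 0 < δ) : ∃ C : ℝ, 0 ≤ C ∧ ∀ (K : ℝ) (_ : 0 ≤ K) (f : ℝ → ℝ)
    (_ : ∀ (n : ℤ) (j : ℕ), |f ((j + 1) * 2 ^ n) - f (j * 2 ^ n)|
      ≤ K * (((2:ℝ) ^ n) ^ γ * (1 + (j + 1) * 2 ^ n) ^ δ)) (N i i' : ℕ), i ≤ i' →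
    |f (i' / 2 ^ N) - f (i / 2 ^ N)| ≤ C * K * ((i' / 2 ^ N - i / 2 ^ N) ^ γ * (1 + i' / 2 ^ N) ^ δ) := by
  set q : ℝ := (2:ℝ) ^ (-γ) with hq
  have hq0 : 0 < q := by positivity
  have hq1 : q < 1 := Real.rpow_lt_one_of_one_lt_of_neg (by norm_num) (by linarith)
  have hgeo : ∀ m, ∑ l ∈ Finset.range m, q ^ (l + 1) ≤ (1 - q)⁻¹ := by
    intro m
    rw [← tsum_geometric_of_lt_one hq0.le hq1]
    refine le_trans ?_ ((summable_geometric_of_lt_one hq0.le hq1).sum_le_tsum (Finset.range m) (fun i _ => by positivity))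
    exact Finset.sum_le_sum fun l _ => pow_le_pow_of_le_one hq0.le hq1.le (by omega)
  have hB : 0 ≤ (1 - q)⁻¹ := inv_nonneg.2 (by linarith)
  refine ⟨2 * (1 - q)⁻¹ + 2, by positivity, ?_⟩
  intro K hK0 f hK N i i' hii
  rcases hii.eq_or_lt with rfl | hlt
  · simp [Real.zero_rpow hγ.ne']
  have hp : (0:ℝ) < 2 ^ N := by positivity
  have hlt' : (i:ℝ) + 1 ≤ i' := by exact_mod_cast hlt
  have hd : (0:ℝ) < i' / 2 ^ N - i / 2 ^ N := by rw [← sub_div]; apply div_pos _ hp; linarith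
  obtain ⟨n, hn1, hn2⟩ := exists_mem_Ico_zpow hd (one_lt_two)
  have hnN : -(N:ℤ) ≤ n := by
    have : (2:ℝ) ^ (-(N:ℤ)) < 2 ^ (n + 1) := by
      refine lt_of_le_of_lt ?_ hn2
      rw [zpow_neg, zpow_natCast, ← sub_div, inv_eq_one_div]
      gcongr; linarith
    have := (zpow_lt_zpow_iff_right₀ (one_lt_two)).1 this
    omega
  obtain ⟨m, hm⟩ : ∃ m : ℕ, n - m = -(N:ℤ) := ⟨(n + N).toNat, by omega⟩
  have hconv : ∀ k : ℕ, (k:ℝ) * 2 ^ (n - (m:ℤ)) = k / 2 ^ N := by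
    intro k; rw [hm, zpow_neg, zpow_natCast]; rfl
  have h2n : (2:ℝ) ^ n = 2 ^ m / 2 ^ N := by
    have : n = m + -(N:ℤ) := by omega
    rw [this, zpow_add₀ (by norm_num), zpow_neg, zpow_natCast, zpow_natCast]; rfl
  have hfl : ∀ k : ℕ, ((k / 2 ^ m : ℕ) : ℝ) * 2 ^ n ≤ k / 2 ^ N := by
    intro k
    rw [h2n, ← mul_div_assoc]
    gcongr
    exact_mod_cast Nat.div_mul_le_self k (2 ^ m)
  have c1 := chain_one γ δ K hδ hK0 f hK n m i
  have c2 := chain_one γ δ K hδ hK0 f hK n m i'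
  rw [hconv] at c1 c2
  have hn2' : i' < i + 2 * 2 ^ m := by
    rw [zpow_add₀ (by norm_num), h2n, zpow_one, ← sub_div, div_mul_eq_mul_div, div_lt_div_iff_of_pos_right hp] at hn2
    have : (i':ℝ) < i + 2 * 2 ^ m := by linarith
    exact_mod_cast this
  have hab : i / 2 ^ m ≤ i' / 2 ^ m := Nat.div_le_div_right hii
  have hba : i' / 2 ^ m ≤ i / 2 ^ m + 2 := by
    rw [← Nat.add_mul_div_right _ _ (by positivity)]
    exact Nat.div_le_div_right hn2'.le
  have hib : (i:ℝ) / 2 ^ N ≤ i' / 2 ^ N := by linarith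
  have hbt := hfl i'
  set b := i' / 2 ^ m
  set a := i / 2 ^ m
  set y : ℝ := (2:ℝ) ^ n
  have hy0 : 0 < y := by positivity
  set t : ℝ := i' / 2 ^ N
  set s : ℝ := i / 2 ^ N
  have hs0 : 0 ≤ s := by positivity
  have ht0 : 0 ≤ t := by positivity
  set R := K * (y ^ γ * (1 + t) ^ δ)
  have hR : 0 ≤ R := by positivity
  have hstep : ∀ k : ℕ, k + 1 ≤ b → |f (((k + 1 : ℕ):ℝ) * y) - f (k * y)| ≤ R := by
    intro k hk
    push_cast
    refine (hK n k).trans ?_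
    have : ((k:ℝ) + 1) * y ≤ t := by
      refine le_trans ?_ hbt
      gcongr
      exact_mod_cast hk
    simp only [R]
    gcongr
  have hmid : |f (b * y) - f (a * y)| ≤ 2 * R := by
    have : b = a ∨ b = a + 1 ∨ b = a + 1 + 1 := by omega
    rcases this with h | h | h
    · rw [h]; simp; positivity
    · have := hstep a h.ge
      rw [h]; linarith
    · have h1 := hstep a (by omega)
      have h2 := hstep (a + 1) h.ge
      rw [h]
      have := abs_sub_le (f (((a + 1 + 1 : ℕ):ℝ) * y)) (f (((a + 1 : ℕ):ℝ) * y)) (f (a * y))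
      linarith
  have c1' : |f s - f (a * y)| ≤ R * (1 - q)⁻¹ := by
    refine c1.trans ?_
    simp only [R]
    gcongr
    exact hgeo m
  have c2' : |f t - f (b * y)| ≤ R * (1 - q)⁻¹ := by
    refine c2.trans ?_
    simp only [R]
    gcongr
    exact hgeo m
  have hfin : R ≤ K * ((t - s) ^ γ * (1 + t) ^ δ) := by
    simp only [R]
    gcongr
  have tri : |f t - f s| ≤ (2 * (1 - q)⁻¹ + 2) * R := by
    have h1 := abs_sub_le (f t) (f (b * y)) (f s)
    have h2 := abs_sub_le (f (b * y)) (f (a * y)) (f s)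
    rw [abs_sub_comm (f (a * y)) (f s)] at h2
    linarith
  refine tri.trans ?_
  rw [mul_assoc]
  gcongr

lemma chain_three (γ δ : ℝ) (hγ : 0 < γ) (hδ : 0 < δ) (K : ℝ) (hK0 : 0 ≤ K) (f : ℝ → ℝ)
    (hK : ∀ (n : ℤ) (j : ℕ), |f ((j + 1) * 2 ^ n) - f (j * 2 ^ n)|
      ≤ K * (((2:ℝ) ^ n) ^ γ * (1 + (j + 1) * 2 ^ n) ^ δ)) : 
    ∃ g : ℝ → ℝ, (∀ t, 0 ≤ t → Filter.Tendsto (fun N : ℕ => f (⌊t * 2 ^ N⌋₊ / 2 ^ N)) Filter.atTop (nhds (g t))) ∧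
      ∃ C, ∀ s t, 0 ≤ s → 0 ≤ t → |g t - g s| ≤ C * (|t - s| ^ γ * (1 + t + s) ^ δ) := by
  obtain ⟨C, hC0, hC⟩ := chain_two γ δ hγ hδ
  -- symmetric, arbitrary levels
  have hsym0 : ∀ N i i' : ℕ, |f (i' / 2 ^ N) - f (i / 2 ^ N)| ≤
      C * K * (|(i' / 2 ^ N - i / 2 ^ N : ℝ)| ^ γ * (1 + i' / 2 ^ N + i / 2 ^ N) ^ δ) := by
    have key : ∀ N i i' : ℕ, i ≤ i' → |f (i' / 2 ^ N) - f (i / 2 ^ N)| ≤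
      C * K * (|(i' / 2 ^ N - i / 2 ^ N : ℝ)| ^ γ * (1 + i' / 2 ^ N + i / 2 ^ N) ^ δ) := by
      intro N i i' h
      refine (hC K hK0 f hK N i i' h).trans ?_
      have h0 : (0:ℝ) ≤ i / 2 ^ N := by positivity
      have h1 : (i:ℝ) / 2 ^ N ≤ i' / 2 ^ N := by gcongr
      rw [abs_of_nonneg (by linarith)]
      have : (0:ℝ) ≤ (i' / 2 ^ N - i / 2 ^ N) := by linarith
      have h4 : (1 + i' / 2 ^ N : ℝ) ^ δ ≤ (1 + i' / 2 ^ N + i / 2 ^ N) ^ δ :=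
        Real.rpow_le_rpow (by positivity) (by linarith) hδ.le
      gcongr
    intro N i i'
    rcases le_total i i' with h | h
    · exact key N i i' h
    · have := key N i' i h
      rw [abs_sub_comm, abs_sub_comm (i' / 2 ^ N : ℝ), add_right_comm]
      exact this
  have hsym : ∀ N M i i' : ℕ, |f (i' / 2 ^ N) - f (i / 2 ^ M)| ≤
      C * K * (|(i' / 2 ^ N - i / 2 ^ M : ℝ)| ^ γ * (1 + i' / 2 ^ N + i / 2 ^ M) ^ δ) := by
    intro N M i i'
    have e1 : (i' / 2 ^ N : ℝ) = ((i' * 2 ^ M : ℕ) : ℝ) / 2 ^ (N + M) := by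
      push_cast; rw [pow_add]; field_simp
    have e2 : (i / 2 ^ M : ℝ) = ((i * 2 ^ N : ℕ) : ℝ) / 2 ^ (N + M) := by
      push_cast; rw [pow_add]; field_simp
    rw [e1, e2]
    exact hsym0 _ _ _
  have hle : ∀ t : ℝ, 0 ≤ t → ∀ N : ℕ, (⌊t * 2 ^ N⌋₊ : ℝ) / 2 ^ N ≤ t := by
    intro t ht N
    rw [div_le_iff₀ (by positivity)]
    exact Nat.floor_le (by positivity)
  have hge : ∀ t : ℝ, 0 ≤ t → ∀ N : ℕ, t - (1/2) ^ N ≤ (⌊t * 2 ^ N⌋₊ : ℝ) / 2 ^ N := by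
    intro t ht N
    rw [le_div_iff₀ (by positivity), sub_mul, ← mul_pow]
    have := Nat.lt_floor_add_one (t * 2 ^ N)
    norm_num
    linarith
  have hpow : Filter.Tendsto (fun N : ℕ => ((1:ℝ)/2) ^ N) Filter.atTop (nhds 0) :=
    tendsto_pow_atTop_nhds_zero_of_lt_one (by norm_num) (by norm_num)
  have hlim : ∀ t : ℝ, 0 ≤ t → Filter.Tendsto (fun N : ℕ => (⌊t * 2 ^ N⌋₊ : ℝ) / 2 ^ N) Filter.atTop (nhds t) := by
    intro t ht
    refine tendsto_of_tendsto_of_tendsto_of_le_of_le (g := fun N : ℕ => t - (1/2) ^ N) ?_ tendsto_const_nhds (hge t ht) (hle t ht)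
    simpa using tendsto_const_nhds.sub hpow
  have hex : ∀ t : ℝ, ∃ l, 0 ≤ t → Filter.Tendsto (fun N : ℕ => f (⌊t * 2 ^ N⌋₊ / 2 ^ N)) Filter.atTop (nhds l) := by
    intro t
    by_cases ht : 0 ≤ t
    swap
    · exact ⟨0, fun h => absurd h ht⟩
    have : CauchySeq (fun N : ℕ => f (⌊t * 2 ^ N⌋₊ / 2 ^ N)) := by
      refine cauchySeq_of_le_tendsto_0 (fun N : ℕ => C * K * (((1/2) ^ N) ^ γ * (1 + t + t) ^ δ)) ?_ ?_
      · intro n m N hn hm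
        rw [Real.dist_eq]
        refine (hsym n m _ _).trans ?_
        have a1 := hle t ht n
        have a2 := hle t ht m
        have a3 := hge t ht n
        have a4 := hge t ht m
        have a5 : ((1:ℝ)/2) ^ n ≤ (1/2) ^ N := pow_le_pow_of_le_one (by norm_num) (by norm_num) hn
        have a6 : ((1:ℝ)/2) ^ m ≤ (1/2) ^ N := pow_le_pow_of_le_one (by norm_num) (by norm_num) hm
        gcongr
        rw [abs_le]; constructor <;> linarith
      · have := (hpow.rpow_const (p := γ) (Or.inr hγ.le))
        rw [Real.zero_rpow hγ.ne'] at this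
        simpa using (this.mul_const ((1 + t + t) ^ δ)).const_mul (C * K)
    obtain ⟨l, hl⟩ := cauchySeq_tendsto_of_complete this
    exact ⟨l, fun _ => hl⟩
  choose g hg using hex
  refine ⟨g, hg, C * K, fun s t hs ht => ?_⟩
  refine le_of_tendsto_of_tendsto ((hg t ht).sub (hg s hs)).abs ?_ (Filter.Eventually.of_forall fun N => hsym N N ⌊s * 2 ^ N⌋₊ ⌊t * 2 ^ N⌋₊)
  refine Filter.Tendsto.const_mul _ (Filter.Tendsto.mul ?_ ?_)
  · exact ((hlim t ht).sub (hlim s hs)).abs.rpow_const (Or.inr hγ.le)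
  · exact ((tendsto_const_nhds.add (hlim t ht)).add (hlim s hs)).rpow_const (Or.inr hδ.le)

lemma dyadic_floor_tendsto (t : ℝ) (ht : 0 ≤ t) :
    Filter.Tendsto (fun N : ℕ => (⌊t * 2 ^ N⌋₊ : ℝ) / 2 ^ N) Filter.atTop (nhds t) := by
  have h := (tendsto_nat_floor_mul_div_atTop ht).comp
    (tendsto_pow_atTop_atTop_of_one_lt (show (1:ℝ) < 2 by norm_num))
  exact h

lemma process_mod {Ω : Type} [MeasurableSpace Ω] (P : Measure Ω) [IsProbabilityMeasure P]
    (H γ δ : ℝ) (hγ₀ : 0 < γ) (hγH : γ < H) (hδ₁ : H - γ < δ)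
    (X : ℝ → Ω → ℝ) (hX : ∀ t, Measurable (X t))
    (hmap : ∀ s t : ℝ, 0 ≤ s → 0 ≤ t → P.map (fun ω => X t ω - X s ω)
      = gaussianReal 0 (.mk ((|t - s| ^ H) ^ 2) (sq_nonneg _))) :
    ∃ Y : ℝ → Ω → ℝ, (∀ t, 0 ≤ t → Measurable (Y t)) ∧ (∀ t, 0 ≤ t → Y t =ᵐ[P] X t) ∧
      ∀ ω, ∃ C, ∀ s t, 0 ≤ s → 0 ≤ t →
        |Y t ω - Y s ω| ≤ C * (|t - s| ^ γ * (1 + t + s) ^ δ) := by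
  have hδ : 0 < δ := by linarith
  have hH : 0 < H := by linarith
  obtain ⟨p, hp⟩ := exists_nat_ge (max (2 / δ) (max (3 / (H - γ)) (1 / (γ + δ - H))))
  have h1 : 2 ≤ δ * p := by
    rw [← div_le_iff₀' hδ]; exact (le_max_left _ _).trans hp
  have h2 : 3 ≤ (H - γ) * p := by
    rw [← div_le_iff₀' (by linarith)]
    exact ((le_max_left _ _).trans (le_max_right _ _)).trans hp
  have h3 : 1 ≤ (γ + δ - H) * p := by
    rw [← div_le_iff₀' (by linarith)]
    exact ((le_max_right _ _).trans (le_max_right _ _)).trans hp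
  have hp0 : p ≠ 0 := by rintro rfl; norm_num at h1
  obtain ⟨m, hm, hmom⟩ := gauss_moment P p
  set D : ℤ × ℕ → ℝ := fun q => ((2:ℝ) ^ q.1) ^ γ * (1 + (q.2 + 1) * 2 ^ q.1) ^ δ with hD
  have hDpos : ∀ q, 0 < D q := fun q => by positivity
  set Δ : ℤ × ℕ → Ω → ℝ := fun q ω => X ((q.2 + 1) * 2 ^ q.1) ω - X (q.2 * 2 ^ q.1) ω with hΔ
  have hΔm : ∀ q, Measurable (Δ q) := fun q => (hX _).sub (hX _)
  set S : Ω → ENNReal := fun ω => ∑' q, ENNReal.ofReal (|Δ q ω| ^ p) * ENNReal.ofReal ((D q ^ p)⁻¹) with hS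
  have hSm : Measurable S := by
    refine Measurable.ennreal_tsum fun q => ?_
    have := hΔm q
    fun_prop
  have hSint : ∫⁻ ω, S ω ∂P ≠ ⊤ := by
    have hterm : ∀ q, ∫⁻ ω, ENNReal.ofReal (|Δ q ω| ^ p) * ENNReal.ofReal ((D q ^ p)⁻¹) ∂P
        ≤ m * ENNReal.ofReal (min ((2:ℝ) ^ q.1) ((2:ℝ) ^ q.1)⁻¹ * (((q.2 : ℝ) + 1) ^ 2)⁻¹) := by
      intro q
      have hy : (0:ℝ) < 2 ^ q.1 := by positivity
      rw [lintegral_mul_const _ (by have := hΔm q; fun_prop)]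
      rw [hmom (Δ q) (|((q.2:ℝ) + 1) * 2 ^ q.1 - q.2 * 2 ^ q.1| ^ H) (hΔm q) (by positivity)
        (hmap _ _ (by positivity) (by positivity))]
      have e : |((q.2:ℝ) + 1) * 2 ^ q.1 - q.2 * 2 ^ q.1| = 2 ^ q.1 := by
        rw [abs_of_nonneg] <;> ring_nf <;> positivity
      rw [e, mul_right_comm, ← ENNReal.ofReal_mul (by positivity), mul_comm]
      gcongr m * ENNReal.ofReal ?_
      have := wsum_bound H γ δ hδ p h1 h2 h3 (2 ^ q.1) (q.2 + 1) hy (by simp)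
      rw [div_pow, div_eq_mul_inv] at this
      exact this
    have : ∫⁻ ω, S ω ∂P ≤ m * ∑' q : ℤ × ℕ, ENNReal.ofReal (min ((2:ℝ) ^ q.1) ((2:ℝ) ^ q.1)⁻¹ * (((q.2 : ℝ) + 1) ^ 2)⁻¹) := by
      rw [lintegral_tsum (fun q => by have := hΔm q; fun_prop), ← ENNReal.tsum_mul_left]
      exact ENNReal.tsum_le_tsum hterm
    exact ne_top_of_le_ne_top (ENNReal.mul_ne_top hm wsum_summable.tsum_ofReal_ne_top) this
  have hSae : ∀ᵐ ω ∂P, S ω < ⊤ := ae_lt_top hSm hSint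
  set G : Set Ω := {ω | S ω < ⊤} with hG
  have hGm : MeasurableSet G := measurableSet_lt hSm measurable_const
  have hex : ∀ ω, ∃ g : ℝ → ℝ, (∀ t, 0 ≤ t → Filter.Tendsto (fun N : ℕ => G.indicator (X (⌊t * 2 ^ N⌋₊ / 2 ^ N)) ω) Filter.atTop (nhds (g t))) ∧
      ∃ C, ∀ s t, 0 ≤ s → 0 ≤ t → |g t - g s| ≤ C * (|t - s| ^ γ * (1 + t + s) ^ δ) := by
    intro ω
    refine chain_three γ δ hγ₀ hδ (1 + (S ω).toReal) (by positivity) (fun t => G.indicator (X t) ω) ?_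
    intro n j
    by_cases hω : ω ∈ G
    · simp only [Set.indicator_of_mem hω]
      have hle : ENNReal.ofReal (|Δ (n, j) ω| ^ p) * ENNReal.ofReal ((D (n, j) ^ p)⁻¹) ≤ S ω :=
        ENNReal.le_tsum (f := fun q => ENNReal.ofReal (|Δ q ω| ^ p) * ENNReal.ofReal ((D q ^ p)⁻¹)) (n, j)
      have hd := hDpos (n, j)
      rw [← ENNReal.ofReal_mul (by positivity), ENNReal.ofReal_le_iff_le_toReal (ne_of_lt hω),
        ← div_eq_mul_inv, ← div_pow] at hle
      have hT : 0 ≤ (S ω).toReal := ENNReal.toReal_nonneg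
      have h5 : (|Δ (n, j) ω| / D (n, j)) ^ p ≤ (1 + (S ω).toReal) ^ p := by
        refine hle.trans ?_
        refine le_trans (by linarith) (le_self_pow₀ (by linarith) hp0)
      have h6 := le_of_pow_le_pow_left₀ hp0 (by positivity) h5
      rw [div_le_iff₀ hd] at h6
      exact h6
    · simp only [Set.indicator_of_notMem hω]
      simp only [sub_self, abs_zero]
      positivity
  choose g hg hgC using hex
  refine ⟨fun t ω => g ω t, ?_, ?_, hgC⟩
  · intro t ht
    refine measurable_of_tendsto_metrizable (f := fun N : ℕ => G.indicator (X (⌊t * 2 ^ N⌋₊ / 2 ^ N))) ?_ ?_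
    · exact fun N => (hX _).indicator hGm
    · rw [tendsto_pi_nhds]
      exact fun ω => hg ω t ht
  · intro t ht
    have hXN : TendstoInMeasure P (fun N : ℕ => X (⌊t * 2 ^ N⌋₊ / 2 ^ N)) Filter.atTop (X t) := by
      refine tendstoInMeasure_of_tendsto_eLpNorm (p := 1) one_ne_zero (fun N => (hX _).aestronglyMeasurable) (hX _).aestronglyMeasurable ?_
      obtain ⟨m1, hm1, hmom1⟩ := gauss_moment P 1
      have : ∀ N : ℕ, eLpNorm (X (⌊t * 2 ^ N⌋₊ / 2 ^ N) - X t) 1 P = ENNReal.ofReal (|(⌊t * 2 ^ N⌋₊ / 2 ^ N : ℝ) - t| ^ H) * m1 := by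
        intro N
        rw [eLpNorm_one_eq_lintegral_enorm]
        have := hmom1 (fun ω => X (⌊t * 2 ^ N⌋₊ / 2 ^ N) ω - X t ω) _ ((hX _).sub (hX _)) (by positivity) (hmap t (⌊t * 2 ^ N⌋₊ / 2 ^ N) ht (by positivity))
        simp only [pow_one] at this
        rw [← this]
        congr 1 with ω
        rw [Pi.sub_apply, ← Real.norm_eq_abs, ofReal_norm]
      simp only [this]
      have h0 : Filter.Tendsto (fun N : ℕ => |(⌊t * 2 ^ N⌋₊ / 2 ^ N : ℝ) - t| ^ H) Filter.atTop (nhds 0) := by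
        have := (((dyadic_floor_tendsto t ht).sub_const t).abs).rpow_const (p := H) (Or.inr hH.le)
        simpa [Real.zero_rpow hH.ne'] using this
      have := ENNReal.Tendsto.mul_const (ENNReal.tendsto_ofReal h0) (Or.inr hm1)
      simpa using this
    have hY : TendstoInMeasure P (fun N : ℕ => X (⌊t * 2 ^ N⌋₊ / 2 ^ N)) Filter.atTop (fun ω => g ω t) := by
      refine tendstoInMeasure_of_tendsto_ae (fun N => (hX _).aestronglyMeasurable) ?_
      filter_upwards [hSae] with ω hω
      have := hg ω t ht
      have hω' : ω ∈ G := hω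
      simpa only [Set.indicator_of_mem hω'] using this
    exact tendstoInMeasure_ae_unique hY hXN

/-- **Lemma 2.5 (existence part)**: for `H ∈ (0,1)`, `γ ∈ (0,H)`, `δ ∈ (H-γ, 1-γ)` and
`d ≥ 1` there exists an `ℝ^d`-valued centered Gaussian process on `(-∞,0]` with continuous
sample paths and the covariance of fractional Brownian motion of Hurst parameter `H`
(in particular `W_0 = 0` a.s.), whose weighted Hölder norm `‖W‖_{γ,δ}` is almost surely
finite. -/
theorem fbm_negative_halfline_weighted_norm (H γ δ : ℝ) (d : ℕ)
    (hH₀ : 0 < H) (hH₁ : H < 1)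
    (hγ₀ : 0 < γ) (hγH : γ < H) (hδ₁ : H - γ < δ) (hδ₂ : δ < 1 - γ) :
    ∃ (Ω : Type) (_ : MeasurableSpace Ω) (P : Measure Ω),
      IsProbabilityMeasure P ∧
      ∃ W : ℝ → Ω → EuclideanSpace ℝ (Fin d),
        (∀ t : ℝ, Measurable (W t)) ∧
        (∀ ω : Ω, ContinuousOn (fun t => W t ω) (Set.Iic 0)) ∧
        -- centered Gaussian process indexed by times `≤ 0`
        (∀ (n : ℕ) (c : Fin n → ℝ) (τ : Fin n → ℝ) (idx : Fin n → Fin d),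
          (∀ k, τ k ≤ 0) →
          ∃ v : NNReal,
            Measure.map (fun ω => ∑ k, c k * W (τ k) ω (idx k)) P = gaussianReal 0 v) ∧
        -- fBm covariance on the negative half-line
        (∀ s t : ℝ, s ≤ 0 → t ≤ 0 → ∀ i j : Fin d,
          (∫ ω, W t ω i * W s ω j ∂P)
            = (if i = j then (1:ℝ) else 0) * (1 / 2)
                * (|t| ^ (2 * H) + |s| ^ (2 * H) - |t - s| ^ (2 * H))) ∧
        -- W₀ = 0 almost surely
        (∀ᵐ ω ∂P, W 0 ω = 0) ∧
        -- almost surely finite weighted Hölder norm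
        (∀ᵐ ω ∂P, BddAbove {q : ℝ | ∃ s t : ℝ, s ≤ 0 ∧ t ≤ 0 ∧ s ≠ t ∧
            q = ‖W t ω - W s ω‖ / (|t - s| ^ γ * (1 + |t| + |s|) ^ δ)}) := by
  have hδ : 0 < δ := by linarith
  obtain ⟨φ, hφ0, hφ⟩ := fbm_curve H hH₀ hH₁
  obtain ⟨Ω, mΩ, P, hP, J, hJ⟩ :=
    isonormal (PiLp 2 (fun _ : Fin d => Lp ℂ 2 (volume.restrict (Set.Ioi (0:ℝ)))))
  set e : Fin d → ℝ → PiLp 2 (fun _ : Fin d => Lp ℂ 2 (volume.restrict (Set.Ioi (0:ℝ)))) :=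
    fun k t => PiLp.single 2 k (φ t) with he
  have hnorm : ∀ k s t, ‖e k t - e k s‖ ^ 2 = |t - s| ^ (2 * H) := by
    intro k s t
    rw [← hφ s t, he]
    simp only
    rw [← PiLp.single_sub, PiLp.norm_single]
  have hinner : ∀ i j s t, inner ℝ (e i t) (e j s) = (if i = j then (1:ℝ) else 0) * (1 / 2)
                * (|t| ^ (2 * H) + |s| ^ (2 * H) - |t - s| ^ (2 * H)) := by
    intro i j s t
    have h1 := hφ 0 t
    have h2 := hφ 0 s
    rw [hφ0, sub_zero, sub_zero] at h1 h2
    rw [← h1, ← h2, ← hφ s t, @norm_sub_sq_real]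
    have hsum : inner ℝ (e i t) (e j s)
        = (if i = j then (1:ℝ) else 0) * inner ℝ (φ t) (φ s) := by
      rw [PiLp.inner_apply, Finset.sum_eq_single i]
      · by_cases hij : i = j
        · subst hij
          simp [he]
        · simp [he, hij]
      · intro b _ hb
        simp [he, hb]
      · intro h
        exact absurd (Finset.mem_univ i) h
    rw [hsum]
    ring
  set X : Fin d → ℝ → Ω → ℝ := fun k t => J (e k t) with hXdef
  have hX : ∀ k t, Measurable (X k t) := fun k t => (Lp.stronglyMeasurable _).measurable
  have hmap : ∀ k, ∀ s t : ℝ, 0 ≤ s → 0 ≤ t → P.map (fun ω => X k t ω - X k s ω)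
      = gaussianReal 0 (.mk ((|t - s| ^ H) ^ 2) (sq_nonneg _)) := by
    intro k s t _ _
    have h1 : (fun ω => X k t ω - X k s ω) =ᵐ[P] J (e k t - e k s) := by
      rw [map_sub]
      exact (Lp.coeFn_sub _ _).symm
    rw [Measure.map_congr h1, hJ]
    congr 1
    apply NNReal.eq
    push_cast
    rw [hnorm]
    change _ = (|t - s| ^ H) ^ 2
    rw [← Real.rpow_mul_natCast (abs_nonneg _)]
    push_cast
    rw [mul_comm]
  have hproc := fun k => process_mod P H γ δ hγ₀ hγH hδ₁ (X k) (hX k) (hmap k)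
  choose Y hYm hYX hYC using hproc
  choose C hC using hYC
  have hbound : ∀ (k : Fin d) (ω : Ω) (s t : ℝ), s ≤ 0 → t ≤ 0 →
      |Y k |t| ω - Y k |s| ω| ≤ C k ω * (|t - s| ^ γ * (1 + |t| + |s|) ^ δ) := by
    intro k ω s t hs ht
    have := hC k ω |s| |t| (abs_nonneg _) (abs_nonneg _)
    have e1 : abs (|t| - |s|) = |t - s| := by
      rw [abs_of_nonpos hs, abs_of_nonpos ht, ← abs_neg]
      congr 1
      ring
    rwa [e1] at this
  have hnb : ∀ (ω : Ω) (s t : ℝ), s ≤ 0 → t ≤ 0 →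
      ‖(WithLp.toLp 2 (fun k => Y k |t| ω) : EuclideanSpace ℝ (Fin d)) - WithLp.toLp 2 (fun k => Y k |s| ω)‖
       ≤ (∑ k, C k ω) * (|t - s| ^ γ * (1 + |t| + |s|) ^ δ) := by
    intro ω s t hs ht
    rw [Finset.sum_mul]
    have h1 : ∀ v : EuclideanSpace ℝ (Fin d), ‖v‖ ≤ ∑ k, |v k| := by
      intro v
      rw [EuclideanSpace.norm_eq]
      apply Real.sqrt_le_iff.2
      refine ⟨by positivity, ?_⟩
      simp only [Real.norm_eq_abs]
      exact Finset.sum_sq_le_sq_sum_of_nonneg (fun i _ => abs_nonneg _)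
    refine (h1 _).trans (Finset.sum_le_sum fun k _ => ?_)
    exact hbound k ω s t hs ht
  have hYJ : ∀ k t, Y k |t| =ᵐ[P] J (e k |t|) := fun k t => hYX k |t| (abs_nonneg _)
  refine ⟨Ω, mΩ, P, hP, fun t ω => WithLp.toLp 2 (fun k => Y k |t| ω), ?_, ?_, ?_, ?_, ?_, ?_⟩
  · intro t
    have : ∀ k, Measurable (Y k |t|) := fun k => hYm k |t| (abs_nonneg _)
    exact (WithLp.measurable_toLp 2 (Fin d → ℝ)).comp (measurable_pi_iff.2 this)
  · intro ω t ht
    rw [ContinuousWithinAt, tendsto_iff_norm_sub_tendsto_zero]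
    have h0 : Filter.Tendsto (fun s : ℝ => (∑ k, C k ω) * (|s - t| ^ γ * (1 + |s| + |t|) ^ δ))
        (nhdsWithin t (Set.Iic 0)) (nhds 0) := by
      have hc : Continuous (fun s : ℝ => (∑ k, C k ω) * (|s - t| ^ γ * (1 + |s| + |t|) ^ δ)) := by
        refine continuous_const.mul (Continuous.mul ?_ ?_)
        · exact Continuous.rpow_const (by fun_prop) (fun _ => Or.inr hγ₀.le)
        · exact Continuous.rpow_const (by fun_prop) (fun _ => Or.inr hδ.le)
      have := (hc.tendsto t).mono_left (nhdsWithin_le_nhds (s := Set.Iic 0))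
      simpa [Real.zero_rpow hγ₀.ne'] using this
    refine squeeze_zero' (Filter.Eventually.of_forall fun _ => norm_nonneg _) ?_ h0
    filter_upwards [self_mem_nhdsWithin] with s hs
    exact hnb ω t s ht hs
  · intro n c τ idx _
    refine ⟨‖∑ k, c k • e (idx k) |τ k|‖₊ ^ 2, ?_⟩
    rw [← hJ, map_sum]
    apply Measure.map_congr
    have h1 : ∀ k, (fun ω => c k * Y (idx k) |τ k| ω) =ᵐ[P] J (c k • e (idx k) |τ k|) := by
      intro k
      rw [map_smul]
      filter_upwards [hYJ (idx k) (τ k), Lp.coeFn_smul (c k) (J (e (idx k) |τ k|))] with ω h1 h2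
      rw [h2, h1]
      rfl
    have h2 := Lp.coeFn_finsetSum Finset.univ (fun k => J (c k • e (idx k) |τ k|))
    filter_upwards [ae_all_iff.2 h1, h2] with ω h1 h2
    rw [h2]
    simp only [Finset.sum_apply]
    exact Finset.sum_congr rfl fun k _ => h1 k
  · intro s t hs ht i j
    have h1 : ∫ ω, Y i |t| ω * Y j |s| ω ∂P = inner ℝ (J (e i |t|)) (J (e j |s|)) := by
      rw [L2.inner_def]
      refine integral_congr_ae ?_
      filter_upwards [hYJ i t, hYJ j s] with ω h1 h2
      rw [h1, h2]
      simp [mul_comm]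
    refine h1.trans ?_
    rw [LinearIsometry.inner_map_map, hinner]
    have e1 : abs (|t| - |s|) = |t - s| := by
      rw [abs_of_nonpos hs, abs_of_nonpos ht, ← abs_neg]
      congr 1
      ring
    rw [e1, abs_abs, abs_abs]
  · have h1 : ∀ k, ∀ᵐ ω ∂P, Y k |0| ω = 0 := by
      intro k
      have h2 : e k |0| = 0 := by simp [he, hφ0]
      have h3 := hYJ k 0
      rw [h2, map_zero] at h3
      filter_upwards [h3, Lp.coeFn_zero ℝ 2 P] with ω h4 h5
      rw [h4, h5]
      rfl
    filter_upwards [ae_all_iff.2 h1] with ω h1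
    ext k
    exact h1 k
  · refine Filter.Eventually.of_forall fun ω => ⟨∑ k, C k ω, ?_⟩
    rintro q ⟨s, t, hs, ht, hst, rfl⟩
    have h1 : 0 < |t - s| := abs_pos.2 (sub_ne_zero.2 hst.symm)
    rw [div_le_iff₀ (by positivity)]
    exact hnb ω s t hs ht
end
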